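/- (Conservation law for the fractional variational problem I[q] = (1/2)∫_0^1 ((ᴿᶜDᵅ q)(t))² dt.) Let 0 < α < 1 and let (q, u, p) be a fractional Pontryagin extremal of this problem on [0,1], i.e. q, p : [0,1] → ℝ of class C¹ and u : [0,1] → ℝ continuous with, for all t ∈ [0,1]: (ᴿᶜDᵅ q)(t) = u(t), (ᴿDᵅ p)(t) = 0, and u(t) + p(t) = 0 (the stationary condition for the Hamiltonian H(q,u,p) = (1/2)u² + p u). Then (ᴿDᵅ [ t ↦ (1 − 2α) p(t)²/2 ])(t) = 0 for all t ∈ [0,1]. -/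

import Mathlib

open Real Set MeasureTheory intervalIntegral
open scoped RealInnerProductSpace

/-- Riesz-type kernel integral of `g` on `[a,b]`:
`(1/(2Γ(1-α))) ∫_a^b |s-θ|^{-α} g(θ) dθ`. -/
noncomputable def rieszInt {E : Type*} [NormedAddCommGroup E] [NormedSpace ℝ E]
    (α a b : ℝ) (g : ℝ → E) (s : ℝ) : E :=
  (1 / (2 * Real.Gamma (1 - α))) • ∫ θ in a..b, |s - θ| ^ (-α) • g θ

/-- Riesz–Caputo fractional derivative of order `α` (for `0 < α < 1`) of `f` on `[a,b]`:
`(1/(2Γ(1-α))) ∫_a^b |t-θ|^{-α} f'(θ) dθ`. -/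
noncomputable def RCDeriv {E : Type*} [NormedAddCommGroup E] [NormedSpace ℝ E]
    (α a b : ℝ) (f : ℝ → E) (t : ℝ) : E :=
  rieszInt α a b (fun θ => derivWithin f (Set.Icc a b) θ) t

/-- Riesz fractional derivative of order `α` (for `0 < α < 1`) of `g` on `[a,b]`:
`d/dt [(1/(2Γ(1-α))) ∫_a^b |t-θ|^{-α} g(θ) dθ]`. -/
noncomputable def RDeriv {E : Type*} [NormedAddCommGroup E] [NormedSpace ℝ E]
    (α a b : ℝ) (g : ℝ → E) (t : ℝ) : E :=
  deriv (rieszInt α a b g) t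

/-- The odd primitive `x |x|^{-α} / (1-α)` of the kernel `|x|^{-α}`. -/
noncomputable def kernelPrimitive (α x : ℝ) : ℝ := x * |x| ^ (-α) / (1 - α)

/-- The Riesz potential `t ↦ ∫_0^1 |t-θ|^{-α} g(θ) dθ`, without normalisation. -/
noncomputable def rieszPotential (α : ℝ) (g : ℝ → ℝ) (t : ℝ) : ℝ :=
  ∫ θ in (0 : ℝ)..1, |t - θ| ^ (-α) * g θ

lemma rieszInt_eq_rieszPotential (α : ℝ) (g : ℝ → ℝ) (t : ℝ) :
    rieszInt α 0 1 g t = (1 / (2 * Real.Gamma (1 - α))) * rieszPotential α g t := rfl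

lemma kernelPrimitive_zero (α : ℝ) : kernelPrimitive α 0 = 0 := by
  simp [kernelPrimitive]

lemma kernelPrimitive_neg (α x : ℝ) : kernelPrimitive α (-x) = -kernelPrimitive α x := by
  simp only [kernelPrimitive, abs_neg]; ring

lemma kernelPrimitive_of_nonneg {α x : ℝ} (hα1 : α < 1) (hx : 0 ≤ x) :
    kernelPrimitive α x = x ^ (1 - α) / (1 - α) := by
  rcases hx.eq_or_lt with rfl | hx
  · rw [kernelPrimitive_zero, Real.zero_rpow (by linarith), zero_div]
  · rw [kernelPrimitive, abs_of_pos hx, sub_eq_add_neg 1 α, Real.rpow_add hx, Real.rpow_one]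

lemma kernelPrimitive_nonneg {α x : ℝ} (hα1 : α < 1) (hx : 0 ≤ x) :
    0 ≤ kernelPrimitive α x := by
  rw [kernelPrimitive_of_nonneg hα1 hx]
  exact div_nonneg (Real.rpow_nonneg hx _) (by linarith)

lemma kernelPrimitive_le {α x : ℝ} (hα1 : α < 1) (hx : 0 ≤ x) (hx1 : x ≤ 1) :
    kernelPrimitive α x ≤ 1 / (1 - α) := by
  rw [kernelPrimitive_of_nonneg hα1 hx]
  have : 0 < 1 - α := by linarith
  gcongr
  exact Real.rpow_le_one hx hx1 this.le

lemma continuous_kernelPrimitive {α : ℝ} (hα1 : α < 1) : Continuous (kernelPrimitive α) := by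
  have h : kernelPrimitive α =
      fun x => (max x 0) ^ (1 - α) / (1 - α) - (max (-x) 0) ^ (1 - α) / (1 - α) := by
    funext x
    have hz : (0 : ℝ) ^ (1 - α) = 0 := Real.zero_rpow (by linarith)
    rcases le_total 0 x with hx | hx
    · rw [kernelPrimitive_of_nonneg hα1 hx, max_eq_left hx, max_eq_right (by linarith), hz]
      simp
    · rw [← neg_neg x, kernelPrimitive_neg, kernelPrimitive_of_nonneg hα1 (by linarith), neg_neg,
        max_eq_left (a := -x) (by linarith), max_eq_right hx, hz]
      simp
  rw [h]
  have hc : Continuous fun y : ℝ => y ^ (1 - α) := Real.continuous_rpow_const (by linarith)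
  fun_prop

lemma hasDerivAt_kernelPrimitive {α x : ℝ} (hα1 : α < 1) (hx : x ≠ 0) :
    HasDerivAt (kernelPrimitive α) (|x| ^ (-α)) x := by
  have hpos : ∀ y : ℝ, 0 < y → HasDerivAt (kernelPrimitive α) (|y| ^ (-α)) y := by
    intro y hy
    have h := (Real.hasDerivAt_rpow_const (x := y) (p := 1 - α) (Or.inl hy.ne')).div_const (1 - α)
    have hα : 1 - α ≠ 0 := by linarith
    rw [mul_div_cancel_left₀ _ hα, show 1 - α - 1 = -α by ring] at h
    rw [abs_of_pos hy]
    refine h.congr_of_eventuallyEq ?_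
    filter_upwards [lt_mem_nhds hy] with z hz
    exact kernelPrimitive_of_nonneg hα1 hz.le
  rcases hx.lt_or_gt with hx | hx
  · have h := ((hpos (-x) (by linarith)).comp x (hasDerivAt_neg x)).neg
    rw [abs_neg, mul_neg_one, neg_neg] at h
    refine h.congr_of_eventuallyEq (Filter.Eventually.of_forall fun z => ?_)
    simp [kernelPrimitive_neg]
  · exact hpos x hx

lemma intervalIntegrable_abs_rpow {α : ℝ} (hα1 : α < 1) (a b : ℝ) :
    IntervalIntegrable (fun x : ℝ => |x| ^ (-α)) volume a b := by
  have h : ∀ c : ℝ, IntervalIntegrable (fun x : ℝ => |x| ^ (-α)) volume 0 c := by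
    intro c
    refine intervalIntegral.intervalIntegrable_deriv_of_nonneg
      (continuous_kernelPrimitive hα1).continuousOn (fun x hx => ?_)
      (fun x _ => Real.rpow_nonneg (abs_nonneg x) _)
    refine hasDerivAt_kernelPrimitive hα1 ?_
    rintro rfl
    rcases le_total 0 c with hc | hc <;> simp [hc] at hx
  exact (h a).symm.trans (h b)

lemma integral_abs_rpow {α : ℝ} (hα1 : α < 1) (a b : ℝ) :
    ∫ x in a..b, |x| ^ (-α) = kernelPrimitive α b - kernelPrimitive α a :=
  integral_eq_of_hasDerivAt_off_countable _ _ (Set.countable_singleton 0)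
    (continuous_kernelPrimitive hα1).continuousOn
    (fun _ hx => hasDerivAt_kernelPrimitive hα1 hx.2) (intervalIntegrable_abs_rpow hα1 a b)

lemma intervalIntegrable_abs_sub_rpow {α : ℝ} (hα1 : α < 1) (t a b : ℝ) :
    IntervalIntegrable (fun x : ℝ => |t - x| ^ (-α)) volume a b := by
  have h := (intervalIntegrable_abs_rpow hα1 (t - a) (t - b)).comp_sub_left t
  simpa using h

lemma integral_abs_sub_rpow {α : ℝ} (hα1 : α < 1) (t a b : ℝ) :
    ∫ x in a..b, |t - x| ^ (-α) = kernelPrimitive α (t - a) - kernelPrimitive α (t - b) := by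
  rw [intervalIntegral.integral_comp_sub_left (fun x => |x| ^ (-α)), integral_abs_rpow hα1]

/-- Restriction of Lebesgue measure to the unit interval. -/
noncomputable abbrev unitVolume : Measure ℝ := volume.restrict (Set.Ioc (0 : ℝ) 1)

lemma memLp_top_of_continuousOn_unit {g : ℝ → ℝ} (hg : ContinuousOn g (Set.Icc 0 1)) :
    MemLp g ⊤ unitVolume := by
  obtain ⟨C, hC⟩ := isCompact_Icc.exists_bound_of_continuousOn hg
  refine memLp_top_of_bound
    ((hg.mono Set.Ioc_subset_Icc_self).aestronglyMeasurable measurableSet_Ioc) C ?_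
  exact ae_restrict_of_forall_mem measurableSet_Ioc fun x hx => hC x (Set.Ioc_subset_Icc_self hx)

lemma integrable_prod_abs_sub_rpow {α : ℝ} (hα1 : α < 1) :
    Integrable (fun z : ℝ × ℝ => |z.1 - z.2| ^ (-α)) (unitVolume.prod unitVolume) := by
  have hm : Measurable fun z : ℝ × ℝ => |z.1 - z.2| ^ (-α) := by fun_prop
  rw [integrable_prod_iff hm.aestronglyMeasurable]
  constructor
  · exact Filter.Eventually.of_forall fun t => (intervalIntegrable_abs_sub_rpow hα1 t 0 1).1
  · have h : (fun t : ℝ => ∫ y, ‖|t - y| ^ (-α)‖ ∂unitVolume) =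
        fun t => kernelPrimitive α (t - 0) - kernelPrimitive α (t - 1) := by
      funext t
      rw [← integral_abs_sub_rpow hα1, intervalIntegral.integral_of_le zero_le_one]
      refine integral_congr_ae (Filter.Eventually.of_forall fun y => ?_)
      exact Real.norm_of_nonneg (Real.rpow_nonneg (abs_nonneg _) _)
    have hk := continuous_kernelPrimitive hα1
    have hc : Continuous fun t => kernelPrimitive α (t - 0) - kernelPrimitive α (t - 1) := by
      fun_prop
    rw [h]
    exact hc.integrableOn_Ioc

lemma intervalIntegrable_rieszPotential {α : ℝ} (hα1 : α < 1) {g : ℝ → ℝ}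
    (hg : MemLp g ⊤ unitVolume) :
    IntervalIntegrable (rieszPotential α g) volume 0 1 := by
  rw [intervalIntegrable_iff_integrableOn_Ioc_of_le zero_le_one]
  have h := ((integrable_prod_abs_sub_rpow hα1).mul_of_top_left
    (hg.comp_snd unitVolume)).integral_prod_left
  refine h.congr (Filter.Eventually.of_forall fun t => ?_)
  simp [rieszPotential, intervalIntegral.integral_of_le]

lemma integral_rieszPotential_mul {α : ℝ} (hα1 : α < 1) {g h : ℝ → ℝ} (hg : MemLp g ⊤ unitVolume)
    (hh : MemLp h ⊤ unitVolume) :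
    ∫ t in (0 : ℝ)..1, rieszPotential α g t * h t =
      ∫ t in (0 : ℝ)..1, g t * rieszPotential α h t := by
  have hint : Integrable (Function.uncurry fun t θ => |t - θ| ^ (-α) * g θ * h t)
      (unitVolume.prod unitVolume) :=
    ((integrable_prod_abs_sub_rpow hα1).mul_of_top_left (hg.comp_snd unitVolume)).mul_of_top_left
      (hh.comp_fst unitVolume)
  have hswap := integral_integral_swap hint
  simp only [rieszPotential, intervalIntegral.integral_of_le (zero_le_one' ℝ)]
  simp only [← MeasureTheory.integral_mul_const, ← MeasureTheory.integral_const_mul]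
  rw [hswap]
  refine integral_congr_ae (Filter.Eventually.of_forall fun t => ?_)
  refine integral_congr_ae (Filter.Eventually.of_forall fun θ => ?_)
  simp only [abs_sub_comm θ t]
  ring

lemma integral_zero_rieszPotential {α b : ℝ} (hα1 : α < 1) {g : ℝ → ℝ} (hg : MemLp g ⊤ unitVolume)
    (hb : b ∈ Set.Icc (0 : ℝ) 1) :
    ∫ t in (0 : ℝ)..b, rieszPotential α g t =
      ∫ θ in (0 : ℝ)..1, g θ * (kernelPrimitive α θ - kernelPrimitive α (θ - b)) := by
  have h1 : MemLp (fun _ : ℝ => (1 : ℝ)) ⊤ unitVolume := memLp_top_const 1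
  have key := integral_rieszPotential_mul hα1 hg (h1.indicator (measurableSet_Iic (a := b)))
  have hL : ∀ t, rieszPotential α g t * (Set.Iic b).indicator (fun _ : ℝ => (1 : ℝ)) t =
      {x | x ≤ b}.indicator (rieszPotential α g) t := by
    intro t
    by_cases ht : t ≤ b <;> simp [Set.indicator, ht]
  have hR : ∀ θ, rieszPotential α ((Set.Iic b).indicator fun _ : ℝ => (1 : ℝ)) θ =
      kernelPrimitive α θ - kernelPrimitive α (θ - b) := by
    intro θ
    have : ∀ t, |θ - t| ^ (-α) * (Set.Iic b).indicator (fun _ : ℝ => (1 : ℝ)) t =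
        {x | x ≤ b}.indicator (fun t => |θ - t| ^ (-α)) t := by
      intro t
      by_cases ht : t ≤ b <;> simp [Set.indicator, ht]
    simp only [rieszPotential, this]
    rw [intervalIntegral.integral_indicator hb, integral_abs_sub_rpow hα1, sub_zero]
  simp only [hL, hR] at key
  rwa [intervalIntegral.integral_indicator hb] at key

section PotentialOfC1

variable {α : ℝ} {p g : ℝ → ℝ}

lemma rieszPotential_eq_sub_integral (hα1 : α < 1) (hp : ContinuousOn p (Set.Icc 0 1))
    (hpg : ∀ x ∈ Set.Ioo (0 : ℝ) 1, HasDerivAt p (g x) x) (hg : ContinuousOn g (Set.Icc 0 1))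
    (t : ℝ) :
    rieszPotential α p t = kernelPrimitive α (1 - t) * p 1 + kernelPrimitive α t * p 0 -
      ∫ θ in (0 : ℝ)..1, kernelPrimitive α (θ - t) * g θ := by
  have hk : Continuous fun θ => kernelPrimitive α (θ - t) :=
    (continuous_kernelPrimitive hα1).comp (by fun_prop)
  have hI : Set.uIcc (0 : ℝ) 1 = Set.Icc 0 1 := Set.uIcc_of_le zero_le_one
  have h1 : IntervalIntegrable (fun θ => |t - θ| ^ (-α) * p θ) volume 0 1 :=
    (intervalIntegrable_abs_sub_rpow hα1 t 0 1).mul_continuousOn (hI ▸ hp)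
  have h2 : IntervalIntegrable (fun θ => kernelPrimitive α (θ - t) * g θ) volume 0 1 :=
    (hk.continuousOn.mul (hI ▸ hg)).intervalIntegrable
  have key := integral_eq_of_hasDerivAt_off_countable_of_le
    (fun θ => kernelPrimitive α (θ - t) * p θ)
    (fun θ => |t - θ| ^ (-α) * p θ + kernelPrimitive α (θ - t) * g θ) zero_le_one
    (Set.countable_singleton t) (hk.continuousOn.mul hp) (fun θ hθ => ?_) (h1.add h2)
  · rw [intervalIntegral.integral_add h1 h2, zero_sub, kernelPrimitive_neg] at key
    rw [rieszPotential]
    linarith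
  · have hne : θ - t ≠ 0 := sub_ne_zero.2 hθ.2
    have h := (hasDerivAt_kernelPrimitive hα1 hne).comp_sub_const θ t
    rw [abs_sub_comm θ t] at h
    exact h.mul (hpg θ hθ.1)

lemma rieszPotential_eq_add_integral (hα1 : α < 1) (hp : ContinuousOn p (Set.Icc 0 1))
    (hpg : ∀ x ∈ Set.Ioo (0 : ℝ) 1, HasDerivAt p (g x) x) (hg : ContinuousOn g (Set.Icc 0 1))
    {b : ℝ} (hb : b ∈ Set.Icc (0 : ℝ) 1) :
    rieszPotential α p b = kernelPrimitive α (1 - b) * p 1 + kernelPrimitive α b * p 0 +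
      (∫ t in (0 : ℝ)..b, rieszPotential α g t) -
      ∫ θ in (0 : ℝ)..1, kernelPrimitive α θ * g θ := by
  have hI : Set.uIcc (0 : ℝ) 1 = Set.Icc 0 1 := Set.uIcc_of_le zero_le_one
  have hk : ∀ t, IntervalIntegrable (fun θ => kernelPrimitive α (θ - t) * g θ) volume 0 1 :=
    fun t => ((((continuous_kernelPrimitive hα1).comp
      (continuous_sub_right t)).continuousOn).mul (hI ▸ hg)).intervalIntegrable
  have hk0 := hk 0
  simp only [sub_zero] at hk0
  rw [rieszPotential_eq_sub_integral hα1 hp hpg hg,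
    integral_zero_rieszPotential hα1 (memLp_top_of_continuousOn_unit hg) hb]
  simp only [mul_comm (g _), sub_mul]
  rw [intervalIntegral.integral_sub hk0 (hk b)]
  ring

lemma ae_rieszPotential_deriv_eq (hα1 : α < 1) (hp : ContinuousOn p (Set.Icc 0 1))
    (hpg : ∀ x ∈ Set.Ioo (0 : ℝ) 1, HasDerivAt p (g x) x) (hg : ContinuousOn g (Set.Icc 0 1))
    (hF : ∀ t ∈ Set.Ioo (0 : ℝ) 1, deriv (rieszPotential α p) t = 0) :
    ∀ᵐ t, t ∈ Set.Ioo (0 : ℝ) 1 →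
      rieszPotential α g t = |1 - t| ^ (-α) * p 1 - |t| ^ (-α) * p 0 := by
  have hae := (intervalIntegrable_rieszPotential hα1
    (memLp_top_of_continuousOn_unit hg)).ae_hasDerivAt_integral
  rw [Set.uIcc_of_le zero_le_one] at hae
  filter_upwards [hae] with t hd ht
  have hd := hd (Set.Ioo_subset_Icc_self ht) 0 (Set.left_mem_Icc.2 zero_le_one)
  have h1 := ((hasDerivAt_kernelPrimitive hα1 (sub_pos.2 ht.2).ne').comp_const_sub 1 t).mul_const
    (p 1)
  have h0 := (hasDerivAt_kernelPrimitive hα1 ht.1.ne').mul_const (p 0)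
  have h := ((h1.add h0).add hd).sub_const (∫ θ in (0 : ℝ)..1, kernelPrimitive α θ * g θ)
  have hev : rieszPotential α p =ᶠ[nhds t] fun b =>
      kernelPrimitive α (1 - b) * p 1 + kernelPrimitive α b * p 0 +
      (∫ t in (0 : ℝ)..b, rieszPotential α g t) -
      ∫ θ in (0 : ℝ)..1, kernelPrimitive α θ * g θ := by
    filter_upwards [Icc_mem_nhds ht.1 ht.2] with b hb
    exact rieszPotential_eq_add_integral hα1 hp hpg hg hb
  have := (h.congr_of_eventuallyEq hev).deriv
  rw [hF t ht] at this
  linarith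

lemma rieszPotential_eq_const (hα1 : α < 1) (hp : ContinuousOn p (Set.Icc 0 1))
    (hpg : ∀ x ∈ Set.Ioo (0 : ℝ) 1, HasDerivAt p (g x) x) (hg : ContinuousOn g (Set.Icc 0 1))
    (hF : ∀ t ∈ Set.Ioo (0 : ℝ) 1, deriv (rieszPotential α p) t = 0)
    {b : ℝ} (hb : b ∈ Set.Icc (0 : ℝ) 1) :
    rieszPotential α p b = rieszPotential α p 0 := by
  have hint : ∫ t in (0 : ℝ)..b, rieszPotential α g t =
      ∫ t in (0 : ℝ)..b, (|1 - t| ^ (-α) * p 1 - |t| ^ (-α) * p 0) := by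
    refine intervalIntegral.integral_congr_ae ?_
    filter_upwards [ae_rieszPotential_deriv_eq hα1 hp hpg hg hF, Measure.ae_ne volume (1 : ℝ)]
      with t ht h1 htb
    rw [Set.uIoc_of_le hb.1] at htb
    exact ht ⟨htb.1, lt_of_le_of_ne (htb.2.trans hb.2) h1⟩
  rw [intervalIntegral.integral_sub ((intervalIntegrable_abs_sub_rpow hα1 1 0 b).mul_const _)
    ((intervalIntegrable_abs_rpow hα1 0 b).mul_const _), intervalIntegral.integral_mul_const,
    intervalIntegral.integral_mul_const, integral_abs_sub_rpow hα1, integral_abs_rpow hα1] at hint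
  rw [rieszPotential_eq_add_integral hα1 hp hpg hg hb,
    rieszPotential_eq_add_integral hα1 hp hpg hg (Set.left_mem_Icc.2 zero_le_one), hint,
    intervalIntegral.integral_same, kernelPrimitive_zero]
  ring

lemma abs_rieszPotential_le (hα1 : α < 1) {M : ℝ} (hM : ∀ x ∈ Set.Icc (0 : ℝ) 1, ‖g x‖ ≤ M)
    {t : ℝ} (ht : t ∈ Set.Icc (0 : ℝ) 1) :
    |rieszPotential α g t| ≤ 2 / (1 - α) * M := by
  have hM0 : 0 ≤ M := (norm_nonneg _).trans (hM t ht)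
  have h : ‖rieszPotential α g t‖ ≤ ∫ θ in (0 : ℝ)..1, |t - θ| ^ (-α) * M := by
    refine intervalIntegral.norm_integral_le_of_norm_le zero_le_one ?_
      ((intervalIntegrable_abs_sub_rpow hα1 t 0 1).mul_const M)
    refine Filter.Eventually.of_forall fun θ hθ => ?_
    rw [norm_mul, Real.norm_of_nonneg (Real.rpow_nonneg (abs_nonneg _) _)]
    exact mul_le_mul_of_nonneg_left (hM θ (Set.Ioc_subset_Icc_self hθ))
      (Real.rpow_nonneg (abs_nonneg _) _)
  rw [intervalIntegral.integral_mul_const, integral_abs_sub_rpow hα1, sub_zero,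
    ← neg_sub 1 t, kernelPrimitive_neg, sub_neg_eq_add] at h
  refine h.trans (mul_le_mul_of_nonneg_right ?_ hM0)
  have h1 := kernelPrimitive_le hα1 ht.1 ht.2
  have h2 := kernelPrimitive_le (x := 1 - t) hα1 (by linarith [ht.2]) (by linarith [ht.1])
  calc _ ≤ 1 / (1 - α) + 1 / (1 - α) := add_le_add h1 h2
    _ = _ := by ring

lemma eq_zero_right_of_deriv_rieszPotential_eq_zero (hα0 : 0 < α) (hα1 : α < 1)
    (hp : ContinuousOn p (Set.Icc 0 1))
    (hpg : ∀ x ∈ Set.Ioo (0 : ℝ) 1, HasDerivAt p (g x) x) (hg : ContinuousOn g (Set.Icc 0 1))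
    (hF : ∀ t ∈ Set.Ioo (0 : ℝ) 1, deriv (rieszPotential α p) t = 0) : p 1 = 0 := by
  by_contra hne
  obtain ⟨M, hM⟩ := isCompact_Icc.exists_bound_of_continuousOn hg
  have hcont : ContinuousAt
      (fun t : ℝ => (1 - t) ^ α * (2 / (1 - α) * M + t ^ (-α) * |p 0|)) 1 := by
    have h1 : ContinuousAt (fun t : ℝ => (1 - t) ^ α) 1 :=
      (continuousAt_const.sub continuousAt_id).rpow_const (Or.inr hα0.le)
    have h2 : ContinuousAt (fun t : ℝ => t ^ (-α)) 1 :=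
      Real.continuousAt_rpow_const _ _ (Or.inl one_ne_zero)
    exact h1.mul (continuousAt_const.add (h2.mul continuousAt_const))
  have hlt : ∀ᶠ t in nhds (1 : ℝ),
      (1 - t) ^ α * (2 / (1 - α) * M + t ^ (-α) * |p 0|) < |p 1| := by
    refine hcont.eventually_lt continuousAt_const ?_
    simpa [Real.zero_rpow hα0.ne'] using hne
  obtain ⟨l, hl, hlt⟩ := exists_Ioc_subset_of_mem_nhds hlt ⟨0, one_pos⟩
  obtain ⟨t, ht, htl⟩ := (Measure.dense_of_ae
    (ae_rieszPotential_deriv_eq hα1 hp hpg hg hF)).exists_between (max_lt hl one_pos)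
  have ht0 : 0 < t := (le_max_right _ _).trans_lt htl.1
  have ht1 : 0 < 1 - t := sub_pos.2 htl.2
  have hbad : (1 - t) ^ α * (2 / (1 - α) * M + t ^ (-α) * |p 0|) < |p 1| :=
    hlt ⟨(le_max_left _ _).trans_lt htl.1, htl.2.le⟩
  refine hbad.not_ge ?_
  have hK := ht ⟨ht0, htl.2⟩
  rw [abs_of_pos ht0, abs_of_pos ht1] at hK
  have hp1 : p 1 = (1 - t) ^ α * (rieszPotential α g t + t ^ (-α) * p 0) := by
    rw [hK, sub_add_cancel, ← mul_assoc, ← Real.rpow_add ht1, add_neg_cancel, Real.rpow_zero,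
      one_mul]
  rw [hp1, abs_mul, abs_of_nonneg (Real.rpow_nonneg ht1.le _)]
  refine mul_le_mul_of_nonneg_left ((abs_add_le _ _).trans ?_) (Real.rpow_nonneg ht1.le _)
  rw [abs_mul (t ^ (-α)), abs_of_nonneg (Real.rpow_nonneg ht0.le _)]
  exact add_le_add_left (abs_rieszPotential_le hα1 hM ⟨ht0.le, htl.2.le⟩) _

lemma rieszPotential_id_mul (hα1 : α < 1) (hg : ContinuousOn g (Set.Icc 0 1)) (t : ℝ) :
    rieszPotential α (fun θ => θ * g θ) t =
      t * rieszPotential α g t +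
        (1 - α) * ∫ θ in (0 : ℝ)..1, kernelPrimitive α (θ - t) * g θ := by
  have hI : Set.uIcc (0 : ℝ) 1 = Set.Icc 0 1 := Set.uIcc_of_le zero_le_one
  have h1 : IntervalIntegrable (fun θ => |t - θ| ^ (-α) * g θ) volume 0 1 :=
    (intervalIntegrable_abs_sub_rpow hα1 t 0 1).mul_continuousOn (hI ▸ hg)
  have h2 : IntervalIntegrable (fun θ => kernelPrimitive α (θ - t) * g θ) volume 0 1 :=
    ((((continuous_kernelPrimitive hα1).comp
      (continuous_sub_right t)).continuousOn).mul (hI ▸ hg)).intervalIntegrable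
  rw [rieszPotential, rieszPotential, ← intervalIntegral.integral_const_mul,
    ← intervalIntegral.integral_const_mul,
    ← intervalIntegral.integral_add (h1.const_mul _) (h2.const_mul _)]
  refine intervalIntegral.integral_congr fun θ _ => ?_
  have : 1 - α ≠ 0 := by linarith
  simp only [kernelPrimitive, abs_sub_comm θ t]
  field_simp
  ring

lemma ae_rieszPotential_id_mul_deriv_eq (hα0 : 0 < α) (hα1 : α < 1)
    (hp : ContinuousOn p (Set.Icc 0 1))
    (hpg : ∀ x ∈ Set.Ioo (0 : ℝ) 1, HasDerivAt p (g x) x) (hg : ContinuousOn g (Set.Icc 0 1))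
    (hF : ∀ t ∈ Set.Ioo (0 : ℝ) 1, deriv (rieszPotential α p) t = 0) :
    ∀ᵐ t, t ∈ Set.Ioo (0 : ℝ) 1 →
      rieszPotential α (fun θ => θ * g θ) t = -((1 - α) * rieszPotential α p 0) := by
  filter_upwards [ae_rieszPotential_deriv_eq hα1 hp hpg hg hF] with t hK ht
  have hC := rieszPotential_eq_sub_integral hα1 hp hpg hg t
  rw [rieszPotential_eq_const hα1 hp hpg hg hF (Set.Ioo_subset_Icc_self ht)] at hC
  have hp1 := eq_zero_right_of_deriv_rieszPotential_eq_zero hα0 hα1 hp hpg hg hF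
  have hkt : (1 - α) * kernelPrimitive α t = t * |t| ^ (-α) := by
    have : 1 - α ≠ 0 := by linarith
    rw [kernelPrimitive, mul_div_cancel₀ _ this]
  rw [rieszPotential_id_mul hα1 hg, hK ht, hC, hp1]
  linear_combination p 0 * hkt

/-- Multiplying the equations of an extremal by the dilation field `θ p'` and integrating shows
that the momentum vanishes unless `α = 1/2`. -/
lemma one_sub_two_mul_integral_sq_eq_zero (hα0 : 0 < α) (hα1 : α < 1)
    (hp : ContinuousOn p (Set.Icc 0 1))
    (hpg : ∀ x ∈ Set.Ioo (0 : ℝ) 1, HasDerivAt p (g x) x) (hg : ContinuousOn g (Set.Icc 0 1))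
    (hF : ∀ t ∈ Set.Ioo (0 : ℝ) 1, deriv (rieszPotential α p) t = 0)
    {v : ℝ → ℝ} (hv : ContinuousOn v (Set.Icc 0 1)) {c : ℝ}
    (hvp : ∀ t ∈ Set.Icc (0 : ℝ) 1, c * rieszPotential α v t = -p t) :
    (1 - 2 * α) * ∫ t in (0 : ℝ)..1, p t ^ 2 = 0 := by
  have hI : Set.uIcc (0 : ℝ) 1 = Set.Icc 0 1 := Set.uIcc_of_le zero_le_one
  have hθg : ContinuousOn (fun θ => θ * g θ) (Set.Icc 0 1) := continuousOn_id.mul hg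
  have hv' := memLp_top_of_continuousOn_unit hv
  have hp1 := eq_zero_right_of_deriv_rieszPotential_eq_zero hα0 hα1 hp hpg hg hF
  have hdil := integral_rieszPotential_mul hα1 (memLp_top_of_continuousOn_unit hθg) hv'
  have hpair := integral_rieszPotential_mul hα1 (memLp_top_of_continuousOn_unit hp) hv'
  have hdilL : ∫ t in (0 : ℝ)..1, rieszPotential α (fun θ => θ * g θ) t * v t =
      -((1 - α) * rieszPotential α p 0) * ∫ t in (0 : ℝ)..1, v t := by
    rw [← intervalIntegral.integral_const_mul]
    refine intervalIntegral.integral_congr_ae ?_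
    filter_upwards [ae_rieszPotential_id_mul_deriv_eq hα0 hα1 hp hpg hg hF,
      Measure.ae_ne volume (1 : ℝ)] with t ht h1 ht01
    rw [Set.uIoc_of_le zero_le_one] at ht01
    rw [ht ⟨ht01.1, lt_of_le_of_ne ht01.2 h1⟩]
  have hpairL : ∫ t in (0 : ℝ)..1, rieszPotential α p t * v t =
      rieszPotential α p 0 * ∫ t in (0 : ℝ)..1, v t := by
    rw [← intervalIntegral.integral_const_mul]
    refine intervalIntegral.integral_congr fun t ht => ?_
    simp only [rieszPotential_eq_const hα1 hp hpg hg hF (hI ▸ ht)]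
  have hdilR : c * ∫ t in (0 : ℝ)..1, (t * g t) * rieszPotential α v t =
      -∫ t in (0 : ℝ)..1, t * (p t * g t) := by
    rw [← intervalIntegral.integral_const_mul, ← intervalIntegral.integral_neg]
    refine intervalIntegral.integral_congr fun t ht => ?_
    have := hvp t (hI ▸ ht)
    linear_combination (t * g t) * this
  have hpairR : c * ∫ t in (0 : ℝ)..1, p t * rieszPotential α v t =
      -∫ t in (0 : ℝ)..1, p t ^ 2 := by
    rw [← intervalIntegral.integral_const_mul, ← intervalIntegral.integral_neg]
    refine intervalIntegral.integral_congr fun t ht => ?_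
    have := hvp t (hI ▸ ht)
    linear_combination p t * this
  have hparts : ∫ t in (0 : ℝ)..1, (p t ^ 2 + 2 * (t * (p t * g t))) = 0 := by
    have h1 : ContinuousOn (fun t => p t ^ 2 + 2 * (t * (p t * g t))) (Set.Icc 0 1) :=
      (hp.pow 2).add (continuousOn_const.mul (continuousOn_id.mul (hp.mul hg)))
    have h := integral_eq_sub_of_hasDerivAt_of_le zero_le_one (f := fun t => t * p t ^ 2)
      (f' := fun t => p t ^ 2 + 2 * (t * (p t * g t))) (continuousOn_id.mul (hp.pow 2))
      (fun t ht => ?_) (hI.symm ▸ h1 : ContinuousOn _ (Set.uIcc (0 : ℝ) 1)).intervalIntegrable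
    · simpa [hp1] using h
    · refine ((hasDerivAt_id t).mul ((hpg t ht).pow 2)).congr_deriv ?_
      simp
      ring
  have hi1 : IntervalIntegrable (fun t => p t ^ 2) volume 0 1 :=
    ContinuousOn.intervalIntegrable (hI.symm ▸ hp.pow 2)
  have hi2 : IntervalIntegrable (fun t => 2 * (t * (p t * g t))) volume 0 1 :=
    ContinuousOn.intervalIntegrable
      (hI.symm ▸ continuousOn_const.mul (continuousOn_id.mul (hp.mul hg)))
  rw [intervalIntegral.integral_add hi1 hi2, intervalIntegral.integral_const_mul] at hparts
  rw [hdilL] at hdil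
  rw [hpairL] at hpair
  rw [← hdil] at hdilR
  rw [← hpair] at hpairR
  linear_combination 2 * hdilR + 2 * (1 - α) * hpairR - hparts

end PotentialOfC1

/-- (Conservation law for the fractional variational problem
`I[q] = (1/2)∫_0^1 ((ᴿᶜDᵅq)(t))² dt`.)  Along any fractional Pontryagin extremal
`(q,u,p)` of this problem, `ᴿDᵅ[t ↦ (1-2α) p(t)²/2] = 0` on `[0,1]`. -/
theorem conservation_law_example_1
    (α : ℝ) (hα0 : 0 < α) (hα1 : α < 1)
    (q : ℝ → ℝ) (hq : ContDiffOn ℝ 1 q (Set.Icc 0 1))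
    (p : ℝ → ℝ) (hp : ContDiffOn ℝ 1 p (Set.Icc 0 1))
    (u : ℝ → ℝ) (hu : ContinuousOn u (Set.Icc 0 1))
    (hHam1 : ∀ t ∈ Set.Icc (0:ℝ) 1, RCDeriv α 0 1 q t = u t)
    (hHam2 : ∀ t ∈ Set.Icc (0:ℝ) 1, RDeriv α 0 1 p t = 0)
    (hstat : ∀ t ∈ Set.Icc (0:ℝ) 1, u t + p t = 0) :
    ∀ t ∈ Set.Icc (0:ℝ) 1,
      RDeriv α 0 1 (fun s => (1 - 2 * α) * (p s) ^ 2 / 2) t = 0 := by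
  have hU : UniqueDiffOn ℝ (Set.Icc (0 : ℝ) 1) := uniqueDiffOn_Icc one_pos
  have hc : (1 / (2 * Real.Gamma (1 - α))) ≠ 0 := by
    have := Real.Gamma_pos_of_pos (s := 1 - α) (by linarith)
    positivity
  have hF : ∀ t ∈ Set.Ioo (0 : ℝ) 1, deriv (rieszPotential α p) t = 0 := by
    intro t ht
    have h := hHam2 t (Set.Ioo_subset_Icc_self ht)
    rw [RDeriv, funext (rieszInt_eq_rieszPotential α p), deriv_const_mul_field] at h
    exact (mul_eq_zero.1 h).resolve_left hc
  have hpg : ∀ x ∈ Set.Ioo (0 : ℝ) 1, HasDerivAt p (derivWithin p (Set.Icc 0 1) x) x :=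
    fun x hx => (hp.differentiableOn one_ne_zero x
      (Set.Ioo_subset_Icc_self hx)).hasDerivWithinAt.hasDerivAt (Icc_mem_nhds hx.1 hx.2)
  have key := one_sub_two_mul_integral_sq_eq_zero hα0 hα1 hp.continuousOn hpg
    (hp.continuousOn_derivWithin hU le_rfl) hF (hq.continuousOn_derivWithin hU le_rfl)
    (fun t ht => (hHam1 t ht).trans (eq_neg_of_add_eq_zero_left (hstat t ht)))
  have hzero : ∀ᵐ θ, θ ∈ Set.uIoc (0 : ℝ) 1 → (1 - 2 * α) * p θ ^ 2 / 2 = 0 := by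
    rcases mul_eq_zero.1 key with h | h
    · simp [h]
    · rw [intervalIntegral.integral_of_le zero_le_one,
        MeasureTheory.integral_eq_zero_iff_of_nonneg (fun x => sq_nonneg (p x))
          ((hp.continuousOn.pow 2).integrableOn_Icc.mono_set Set.Ioc_subset_Icc_self)] at h
      rw [Set.uIoc_of_le zero_le_one, ← ae_restrict_iff' measurableSet_Ioc]
      filter_upwards [h] with θ hθ
      simp only [Pi.zero_apply] at hθ
      simp [hθ]
  have hI : ∀ s, rieszInt α 0 1 (fun s => (1 - 2 * α) * (p s) ^ 2 / 2) s = 0 := by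
    intro s
    rw [rieszInt_eq_rieszPotential, rieszPotential, intervalIntegral.integral_zero_ae, mul_zero]
    filter_upwards [hzero] with θ hθ hmem
    rw [hθ hmem, mul_zero]
  intro t _
  rw [RDeriv, funext hI, deriv_const]
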